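/- Let A be an abelian category and L ⊆ Ext¹(Y, K) a finitely generated Γ(K)-submodule. There exists a universal L-extension of Y by K if and only if L admits a projective cover as a Γ(K)-module. -/

import Mathlib

set_option linter.unusedSectionVars false

open CategoryTheory Abelian Limits

universe w v u

attribute [local instance] CategoryTheory.Abelian.hasFiniteBiproducts

variable {A : Type u} [Category.{v} A] [Abelian A]

/-- `M` belongs to `add K`: it is a direct summand of a finite direct sum of copies of `K`. -/
def InAdd (K M : A) : Prop :=
  ∃ (n : ℕ) (s : M ⟶ ⨁ (fun _ : Fin n => K)) (r : (⨁ fun _ : Fin n => K) ⟶ M),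
    s ≫ r = 𝟙 M

/-- `α` factors through `α'`. -/
def Factors {X X' Y : A} (α : X ⟶ Y) (α' : X' ⟶ Y) : Prop :=
  ∃ v : X ⟶ X', v ≫ α' = α

/-- `α` and `α'` are right equivalent. -/
def RightEquiv {X X' Y : A} (α : X ⟶ Y) (α' : X' ⟶ Y) : Prop :=
  Factors α α' ∧ Factors α' α

/-- A morphism is right minimal. -/
def RightMinimal {X Y : A} (α : X ⟶ Y) : Prop :=
  ∀ v : X ⟶ X, v ≫ α = α → IsIso v

/-- A short exact sequence `0 → K → X → Y → 0`. -/
structure SES (K Y : A) where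
  X : A
  i : K ⟶ X
  p : X ⟶ Y
  zero : i ≫ p = 0
  shortExact : (ShortComplex.mk i p zero).ShortExact

variable [HasExt.{w} A]

lemma Ext.mk₀_add' {X Y : A} (f g : X ⟶ Y) :
    Ext.mk₀ (f + g) = Ext.mk₀ f + Ext.mk₀ g := by
  letI := HasDerivedCategory.standard A
  apply Ext.ext
  simp [Ext.add_hom, ShiftedHom.mk₀, Functor.map_add]

/-- The class `[ξ] ∈ Ext¹(Y, K)` of a short exact sequence `ξ`. -/
noncomputable def SES.cls {K Y : A} (E : SES K Y) : Ext Y K 1 :=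
  E.shortExact.extClass

/-- The class `[u.ξ]` of the pushout of `ξ` along `u`. -/
noncomputable def SES.push {K Y Z : A} (E : SES K Y) (u : K ⟶ Z) : Ext Y Z 1 :=
  E.cls.comp (Ext.mk₀ u) (add_zero 1)

noncomputable instance extSMulEnd (Y K : A) : SMul (End K) (Ext Y K 1) :=
  ⟨fun g e => e.comp (Ext.mk₀ g) (add_zero 1)⟩

lemma extSmul_def {Y K : A} (g : End K) (e : Ext Y K 1) :
    g • e = e.comp (Ext.mk₀ g) (add_zero 1) := rfl

/-- `Ext¹(Y, K)` as a left module over `Γ(K) = End K`, via pushout. -/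
noncomputable instance extModuleEnd (Y K : A) : Module (End K) (Ext Y K 1) where
  one_smul e := by rw [extSmul_def]; exact Ext.comp_mk₀_id e
  mul_smul g h e := by
    rw [extSmul_def, extSmul_def, extSmul_def,
      Ext.comp_assoc_of_third_deg_zero, Ext.mk₀_comp_mk₀]
    rfl
  smul_add g e f := by
    rw [extSmul_def, extSmul_def, extSmul_def]; exact Ext.add_comp e f _ _
  add_smul g h e := by
    rw [extSmul_def, extSmul_def, extSmul_def, Ext.mk₀_add', Ext.comp_add]
  zero_smul e := by rw [extSmul_def]; rw [Ext.mk₀_zero, Ext.comp_zero]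
  smul_zero g := by rw [extSmul_def]; exact Ext.zero_comp _ _ _ _ _

/-- The connecting map `c(ξ, K) : Hom(K₁, K) → Ext¹(Y, K)`, `u ↦ [u.ξ]`,
as a morphism of left `Γ(K) = End K`-modules. -/
noncomputable def SES.conn {K₁ Y : A} (E : SES K₁ Y) (K : A) :
    (K₁ ⟶ K) →ₗ[End K] Ext Y K 1 where
  toFun u := E.push u
  map_add' u v := by
    dsimp [SES.push]
    rw [Ext.mk₀_add', Ext.comp_add]
  map_smul' g u := by
    dsimp [SES.push]
    rw [End.smul_right, extSmul_def, Ext.comp_assoc_of_third_deg_zero,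
      Ext.mk₀_comp_mk₀]

/-- Right minimality for a morphism of modules. -/
def ModRightMinimal {R : Type*} [Ring R] {M N : Type*} [AddCommGroup M] [AddCommGroup N]
    [Module R M] [Module R N] (c : M →ₗ[R] N) : Prop :=
  ∀ g : M →ₗ[R] M, c.comp g = c → Function.Bijective g

universe w'

/-- The `R`-module `M` admits a projective cover. -/
def HasProjCover (R : Type*) [Ring R] (M : Type w') [AddCommGroup M] [Module R M] : Prop :=
  ∃ (P : Type w') (_ : AddCommGroup P) (_ : Module R P) (f : P →ₗ[R] M),
    Module.Projective R P ∧ Function.Surjective f ∧ ModRightMinimal f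

/-- `ξ` is a universal `L`-extension of `Y` by `K`. -/
def IsUniversalExt (K : A) {K₁ Y : A} (E : SES K₁ Y) (L : Submodule (End K) (Ext Y K 1)) :
    Prop :=
  InAdd K K₁ ∧ LinearMap.range (E.conn K) = L ∧ ModRightMinimal (E.conn K)

lemma InAdd.self (K : A) : InAdd K K := by
  refine ⟨1, biproduct.ι (fun _ : Fin 1 => K) (0 : Fin 1), biproduct.π (fun _ : Fin 1 => K) 0, ?_⟩
  simp

section Realization

open Pretriangulated DerivedCategory

universe t

variable {C : Type u} [Category.{v} C] [Abelian C] [HasDerivedCategory.{t} C]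

/-- A distinguished triangle in the derived category whose first two morphisms come from
the abelian category is given by a short exact sequence. -/
lemma shortExact_of_distinguished {S : ShortComplex C}
    {h : (singleFunctor C 0).obj S.X₃ ⟶ ((singleFunctor C 0).obj S.X₁)⟦(1 : ℤ)⟧}
    (hT : Triangle.mk ((singleFunctor C 0).map S.f) ((singleFunctor C 0).map S.g) h ∈
      distTriang (DerivedCategory C)) : S.ShortExact := by
  have hzero {T U : C} (u : ((singleFunctor C 0).obj T)⟦(1 : ℤ)⟧ ⟶ (singleFunctor C 0).obj U) :
      u = 0 :=
    TStructure.t.zero_of_isLE_of_isGE u (-1) 0 (by lia)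
      (TStructure.t.isLE_shift _ 0 1 (-1)) inferInstance
  have hf : Mono S.f := by
    refine Preadditive.mono_of_cancel_zero _ fun {T} t ht ↦ ?_
    have ht' : ((singleFunctor C 0).map t)⟦(1 : ℤ)⟧' ≫ ((singleFunctor C 0).map S.f)⟦(1 : ℤ)⟧' =
        0 := by
      rw [← Functor.map_comp, ← Functor.map_comp, ht, Functor.map_zero, Functor.map_zero]
    obtain ⟨u, hu⟩ : ∃ u : ((singleFunctor C 0).obj T)⟦(1 : ℤ)⟧ ⟶ (singleFunctor C 0).obj S.X₃,
        ((singleFunctor C 0).map t)⟦(1 : ℤ)⟧' = u ≫ h := Triangle.coyoneda_exact₁ _ hT _ ht'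
    rw [hzero u, zero_comp] at hu
    apply (singleFunctor C 0).map_injective
    apply (shiftFunctor (DerivedCategory C) (1 : ℤ)).map_injective
    rw [hu, Functor.map_zero, Functor.map_zero]
  have hg : Epi S.g := by
    refine Preadditive.epi_of_cancel_zero _ fun {T} t ht ↦ ?_
    have ht' : (singleFunctor C 0).map S.g ≫ (singleFunctor C 0).map t = 0 := by
      rw [← Functor.map_comp, ht, Functor.map_zero]
    obtain ⟨u, hu⟩ : ∃ u : ((singleFunctor C 0).obj S.X₁)⟦(1 : ℤ)⟧ ⟶ (singleFunctor C 0).obj T,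
        (singleFunctor C 0).map t = h ≫ u := Triangle.yoneda_exact₃ _ hT _ ht'
    rw [hzero u, comp_zero] at hu
    apply (singleFunctor C 0).map_injective
    rw [hu, Functor.map_zero]
  have hlift {T : C} (t : T ⟶ S.X₂) (ht : t ≫ S.g = 0) : ∃ l : T ⟶ S.X₁, l ≫ S.f = t := by
    have ht' : (singleFunctor C 0).map t ≫ (singleFunctor C 0).map S.g = 0 := by
      rw [← Functor.map_comp, ht, Functor.map_zero]
    obtain ⟨u, hu⟩ : ∃ u : (singleFunctor C 0).obj T ⟶ (singleFunctor C 0).obj S.X₁,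
        (singleFunctor C 0).map t = u ≫ (singleFunctor C 0).map S.f :=
      Triangle.coyoneda_exact₂ _ hT _ ht'
    obtain ⟨l, rfl⟩ := (singleFunctor C 0).map_surjective u
    exact ⟨l, (singleFunctor C 0).map_injective (by rw [hu, Functor.map_comp])⟩
  exact {
    exact := S.exact_of_f_is_kernel (KernelFork.IsLimit.ofι' _ _ fun t ht ↦
      ⟨(hlift t ht).choose, (hlift t ht).choose_spec⟩) }

/-- The third morphism of a distinguished triangle whose first two morphisms come from a
short exact sequence is the connecting morphism of that sequence. -/
lemma eq_singleδ_of_distinguished {S : ShortComplex C} (hS : S.ShortExact)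
    {h : (singleFunctor C 0).obj S.X₃ ⟶ ((singleFunctor C 0).obj S.X₁)⟦(1 : ℤ)⟧}
    (hT : Triangle.mk ((singleFunctor C 0).map S.f) ((singleFunctor C 0).map S.g) h ∈
      distTriang (DerivedCategory C)) : h = hS.singleδ := by
  obtain ⟨c, hc₁, hc₂⟩ : ∃ c : (singleFunctor C 0).obj S.X₃ ⟶ (singleFunctor C 0).obj S.X₃,
      (singleFunctor C 0).map S.g ≫ c = 𝟙 _ ≫ (singleFunctor C 0).map S.g ∧
      h ≫ (𝟙 ((singleFunctor C 0).obj S.X₁))⟦(1 : ℤ)⟧' = c ≫ hS.singleδ :=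
    complete_distinguished_triangle_morphism _ _ hT hS.singleTriangle_distinguished (𝟙 _) (𝟙 _)
      ((Category.comp_id _).trans (Category.id_comp _).symm)
  obtain ⟨c, rfl⟩ := (singleFunctor C 0).map_surjective c
  have := hS.epi_g
  have hc : c = 𝟙 _ := by
    rw [← cancel_epi S.g]
    apply (singleFunctor C 0).map_injective
    rw [Functor.map_comp, hc₁, Category.id_comp, Category.comp_id]
  subst hc
  rwa [CategoryTheory.Functor.map_id, CategoryTheory.Functor.map_id, Category.comp_id, Category.id_comp] at hc₂

/-- Every morphism `Y ⟶ M⟦1⟧` in the derived category between objects of the abelian category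
is the connecting morphism of a short exact sequence. -/
lemma exists_singleδ_eq {M Y : C}
    (h : (singleFunctor C 0).obj Y ⟶ ((singleFunctor C 0).obj M)⟦(1 : ℤ)⟧) :
    ∃ (X : C) (i : M ⟶ X) (p : X ⟶ Y) (zero : i ≫ p = 0)
      (hS : (ShortComplex.mk i p zero).ShortExact), hS.singleδ = h := by
  obtain ⟨X, f, g, hT⟩ := distinguished_cocone_triangle₂ h
  have : X.IsLE 0 := TStructure.t.isLE₂ _ hT 0
    (inferInstanceAs (((singleFunctor C 0).obj M).IsLE 0))
    (inferInstanceAs (((singleFunctor C 0).obj Y).IsLE 0))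
  have : X.IsGE 0 := TStructure.t.isGE₂ _ hT 0
    (inferInstanceAs (((singleFunctor C 0).obj M).IsGE 0))
    (inferInstanceAs (((singleFunctor C 0).obj Y).IsGE 0))
  obtain ⟨X₀, ⟨e⟩⟩ := exists_iso_singleFunctor_obj_of_isGE_of_isLE X 0
  obtain ⟨i, hi⟩ := (singleFunctor C 0).map_surjective (f ≫ e.hom)
  obtain ⟨p, hp⟩ := (singleFunctor C 0).map_surjective (e.inv ≫ g)
  have hT' : Triangle.mk ((singleFunctor C 0).map i) ((singleFunctor C 0).map p) h ∈
      distTriang (DerivedCategory C) := by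
    rw [hi, hp]
    refine isomorphic_distinguished _ hT _
      (Triangle.isoMk _ _ (Iso.refl _) e.symm (Iso.refl _) ?_ ?_ ?_)
    · change (f ≫ e.hom) ≫ e.inv = 𝟙 _ ≫ f
      simp
    · change (e.inv ≫ g) ≫ 𝟙 _ = e.inv ≫ g
      simp
    · change h ≫ (𝟙 ((singleFunctor C 0).obj M))⟦(1 : ℤ)⟧' = 𝟙 _ ≫ h
      simp
  have zero : i ≫ p = 0 := by
    apply (singleFunctor C 0).map_injective
    rw [Functor.map_comp, Functor.map_zero]
    exact comp_distTriang_mor_zero₁₂ _ hT'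
  have hS : (ShortComplex.mk i p zero).ShortExact := shortExact_of_distinguished hT'
  exact ⟨X₀, i, p, zero, hS, (eq_singleδ_of_distinguished hS hT').symm⟩

/-- Every class in `Ext¹(Y, M)` is the class of a short exact sequence `0 → M → X → Y → 0`. -/
lemma SES.exists_cls_eq {M Y : A} (x : Ext Y M 1) : ∃ E : SES M Y, E.cls = x := by
  let := HasDerivedCategory.standard A
  obtain ⟨X, i, p, zero, hS, h⟩ := exists_singleδ_eq x.hom
  exact ⟨⟨X, i, p, zero, hS⟩, Ext.homEquiv.injective (hS.extClass_hom.trans h)⟩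

end Realization

section Modules

variable {R M N N' : Type*} [Ring R] [AddCommGroup M] [AddCommGroup N] [AddCommGroup N']
  [Module R M] [Module R N] [Module R N']

lemma ModRightMinimal.comp_linearEquiv {c : M →ₗ[R] N} (hc : ModRightMinimal c)
    (e : N' ≃ₗ[R] M) : ModRightMinimal (c ∘ₗ (e : N' →ₗ[R] M)) := by
  intro g hg
  have h := hc ((e : N' →ₗ[R] M) ∘ₗ g ∘ₗ (e.symm : M →ₗ[R] N')) (by
    ext x
    simpa using LinearMap.congr_fun hg (e.symm x))
  simpa using h

lemma modRightMinimal_comp_iff_of_injective (c : M →ₗ[R] N) {j : N →ₗ[R] N'}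
    (hj : Function.Injective j) : ModRightMinimal (j ∘ₗ c) ↔ ModRightMinimal c := by
  have h (g : M →ₗ[R] M) : (j ∘ₗ c) ∘ₗ g = j ∘ₗ c ↔ c ∘ₗ g = c := by
    rw [LinearMap.comp_assoc]
    exact ⟨fun h ↦ LinearMap.ext fun x ↦ hj (LinearMap.congr_fun h x), fun h ↦ by rw [h]⟩
  simp only [ModRightMinimal, h]

/-- The source of a projective cover of a finitely generated module is a direct summand of a
finite free module. -/
lemma ModRightMinimal.exists_retract [Module.Projective R M] [Module.Finite R N]
    {f : M →ₗ[R] N} (hf : Function.Surjective f) (hmin : ModRightMinimal f) :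
    ∃ (n : ℕ) (s : M →ₗ[R] Fin n → R) (r : (Fin n → R) →ₗ[R] M), r ∘ₗ s = LinearMap.id := by
  obtain ⟨n, q, hq⟩ := Module.Finite.exists_fin' R N
  obtain ⟨h, hh⟩ := Module.projective_lifting_property f q hf
  obtain ⟨k, hk⟩ := Module.projective_lifting_property q f hq
  let e := LinearEquiv.ofBijective (h ∘ₗ k)
    (hmin _ (by rw [← LinearMap.comp_assoc, hh, hk]))
  refine ⟨n, k, (e.symm : M →ₗ[R] M) ∘ₗ h, ?_⟩
  ext x
  exact e.symm_apply_apply x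

end Modules

section EndLinear

/-- Precomposition with `f : X ⟶ Z`, as an `End K`-linear map. -/
def precompEnd (K : A) {X Z : A} (f : X ⟶ Z) : (Z ⟶ K) →ₗ[End K] (X ⟶ K) where
  toFun u := f ≫ u
  map_add' u v := Preadditive.comp_add _ _ _ f u v
  map_smul' g u := by simp [End.smul_right]

@[simp]
lemma precompEnd_apply {K X Z : A} (f : X ⟶ Z) (u : Z ⟶ K) : precompEnd K f u = f ≫ u := rfl

/-- The `End K`-module of morphisms from `Kⁿ` to `K` is free of rank `n`. -/
noncomputable def homBiproductEquiv (K : A) (n : ℕ) :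
    ((⨁ fun _ : Fin n => K) ⟶ K) ≃ₗ[End K] (Fin n → End K) where
  toFun u j := biproduct.ι (fun _ : Fin n => K) j ≫ u
  invFun v := biproduct.desc v
  map_add' u v := by
    ext j
    exact Preadditive.comp_add _ _ _ _ _ _
  map_smul' g u := by
    ext j
    exact (Category.assoc _ _ _).symm
  left_inv u := by
    ext j
    simp
  right_inv v := by
    ext j
    simp

lemma sum_smul_retract {K M : A} {n : ℕ} {s : M ⟶ ⨁ fun _ : Fin n => K}
    {r : (⨁ fun _ : Fin n => K) ⟶ M} (hsr : s ≫ r = 𝟙 M) (u : M ⟶ K) :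
    ∑ j, (End.of (biproduct.ι (fun _ : Fin n => K) j ≫ r ≫ u)) •
      (s ≫ biproduct.π (fun _ : Fin n => K) j) = u := by
  have h : ∑ j, (s ≫ biproduct.π (fun _ : Fin n => K) j) ≫
      biproduct.ι (fun _ : Fin n => K) j ≫ r ≫ u = u := by
    simp only [Category.assoc, ← Preadditive.comp_sum]
    simp only [← Category.assoc, ← Preadditive.sum_comp]
    rw [biproduct.total, Category.comp_id, hsr, Category.id_comp]
  exact h

lemma InAdd.projective_hom {K M : A} (hM : InAdd K M) : Module.Projective (End K) (M ⟶ K) := by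
  obtain ⟨n, s, r, hsr⟩ := hM
  have := Module.Projective.of_equiv (homBiproductEquiv K n).symm
  exact Module.Projective.of_split (precompEnd K r) (precompEnd K s)
    (LinearMap.ext fun u ↦ by simp [reassoc_of% hsr])

/-- Every `End K`-linear map on `Hom(M, K)` with `M ∈ add K` is given by precomposition. -/
lemma InAdd.exists_precompEnd_eq {K M Z : A} (hM : InAdd K M)
    (φ : (M ⟶ K) →ₗ[End K] (Z ⟶ K)) : ∃ e : Z ⟶ M, precompEnd K e = φ := by
  obtain ⟨n, s, r, hsr⟩ := hM
  refine ⟨∑ j, φ (s ≫ biproduct.π _ j) ≫ biproduct.ι (fun _ : Fin n => K) j ≫ r,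
    LinearMap.ext fun u ↦ ?_⟩
  conv_rhs => rw [← sum_smul_retract hsr u, map_sum]
  rw [precompEnd_apply, Preadditive.sum_comp]
  refine Finset.sum_congr rfl fun j _ ↦ ?_
  rw [map_smul, End.smul_right]
  simp [End.of]

/-- A direct summand of a finite free `End K`-module is isomorphic to `Hom(M, K)` for some
`M ∈ add K`. -/
lemma exists_inAdd_linearEquiv {K : A} {P : Type*} [AddCommGroup P] [Module (End K) P] {n : ℕ}
    (s : P →ₗ[End K] Fin n → End K) (r : (Fin n → End K) →ₗ[End K] P)
    (hrs : r ∘ₗ s = LinearMap.id) :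
    ∃ M : A, InAdd K M ∧ Nonempty ((M ⟶ K) ≃ₗ[End K] P) := by
  let ε := homBiproductEquiv K n
  let s' : P →ₗ[End K] ((⨁ fun _ : Fin n => K) ⟶ K) := ε.symm.toLinearMap ∘ₗ s
  let r' : ((⨁ fun _ : Fin n => K) ⟶ K) →ₗ[End K] P := r ∘ₗ ε.toLinearMap
  have hrs' (x : P) : r' (s' x) = x := by
    simpa [r', s'] using LinearMap.congr_fun hrs x
  obtain ⟨e, he⟩ := InAdd.exists_precompEnd_eq (K := K) (M := ⨁ fun _ : Fin n => K)
    ⟨n, 𝟙 _, 𝟙 _, Category.comp_id _⟩ (s' ∘ₗ r')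
  have he' (u : (⨁ fun _ : Fin n => K) ⟶ K) : e ≫ u = s' (r' u) := LinearMap.congr_fun he u
  have hidem : e ≫ e = e := by
    ext j
    simp only [Category.assoc, he', hrs']
  obtain ⟨M, i, q, hiq, hqi⟩ := IsIdempotentComplete.idempotents_split _ e hidem
  refine ⟨M, ⟨n, i, q, hiq⟩, ⟨LinearEquiv.ofLinearMap (r' ∘ₗ precompEnd K q)
    (precompEnd K i ∘ₗ s') ?_ ?_⟩⟩
  · ext x
    simp [reassoc_of% hqi, he', hrs']
  · ext u
    simp [← he', ← hqi, reassoc_of% hiq]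

end EndLinear

/-- Every `End K`-linear map `Hom(M, K) → Ext¹(Y, K)` with `M ∈ add K` is a connecting map. -/
lemma InAdd.exists_conn_eq {K M Y : A} (hM : InAdd K M)
    (φ : (M ⟶ K) →ₗ[End K] Ext Y K 1) : ∃ E : SES M Y, E.conn K = φ := by
  obtain ⟨n, s, r, hsr⟩ := hM
  obtain ⟨E, hE⟩ := SES.exists_cls_eq (∑ j, (φ (s ≫ biproduct.π _ j)).comp
    (Ext.mk₀ (biproduct.ι (fun _ : Fin n => K) j ≫ r)) (add_zero 1))
  refine ⟨E, LinearMap.ext fun u ↦ ?_⟩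
  conv_rhs => rw [← sum_smul_retract hsr u, map_sum]
  change E.cls.comp (Ext.mk₀ u) (add_zero 1) = _
  rw [hE, Ext.sum_comp]
  refine Finset.sum_congr rfl fun j _ ↦ ?_
  rw [map_smul, extSmul_def, Ext.comp_assoc_of_third_deg_zero, Ext.mk₀_comp_mk₀]
  simp [End.of]

lemma IsUniversalExt.hasProjCover {K K₁ Y : A} {E : SES K₁ Y}
    {L : Submodule (End K) (Ext Y K 1)} (h : IsUniversalExt K E L) : HasProjCover (End K) L := by
  obtain ⟨hadd, rfl, hmin⟩ := h
  have : Small.{w} (K₁ ⟶ K) := ⟨_, ⟨Ext.homEquiv₀.symm⟩⟩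
  let e := Shrink.linearEquiv.{w} (End K) (K₁ ⟶ K)
  have := hadd.projective_hom
  refine ⟨Shrink.{w} (K₁ ⟶ K), inferInstance, inferInstance,
    (E.conn K).rangeRestrict ∘ₗ e.toLinearMap, Module.Projective.of_equiv e.symm, ?_, ?_⟩
  · exact (E.conn K).surjective_rangeRestrict.comp e.surjective
  · apply ModRightMinimal.comp_linearEquiv
    exact (modRightMinimal_comp_iff_of_injective _
      (LinearMap.range (E.conn K)).injective_subtype).1 hmin

lemma HasProjCover.exists_isUniversalExt {K Y : A} {L : Submodule (End K) (Ext Y K 1)}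
    (hL : L.FG) (h : HasProjCover (End K) L) :
    ∃ (K₁ : A) (E : SES K₁ Y), IsUniversalExt K E L := by
  obtain ⟨P, _, _, f, _, hf, hmin⟩ := h
  have := Module.Finite.of_fg hL
  obtain ⟨n, s, r, hrs⟩ := hmin.exists_retract hf
  obtain ⟨K₁, hadd, ⟨e⟩⟩ := exists_inAdd_linearEquiv s r hrs
  obtain ⟨E, hE⟩ := hadd.exists_conn_eq (L.subtype ∘ₗ f ∘ₗ e.toLinearMap)
  refine ⟨K₁, E, hadd, ?_, ?_⟩
  · rw [hE, LinearMap.range_comp, LinearMap.range_eq_top.2 (hf.comp e.surjective :),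
      Submodule.map_top, Submodule.range_subtype]
  · rw [hE, modRightMinimal_comp_iff_of_injective _ L.injective_subtype]
    exact hmin.comp_linearEquiv e

/-- a universal `L`-extension of `Y` by `K` exists iff the
`Γ(K)`-module `L` admits a projective cover. -/
theorem stmt13 (K Y : A) (L : Submodule (End K) (Ext Y K 1)) (hL : L.FG) :
    (∃ (K₁ : A) (E : SES K₁ Y), IsUniversalExt K E L) ↔ HasProjCover (End K) L := by
  exact ⟨fun ⟨_, _, h⟩ ↦ h.hasProjCover, fun h ↦ h.exists_isUniversalExt hL⟩
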